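/- Fix α ∈ (0,1). Let P and Q be probability measures on a measurable space Z and let g : Z → [0,∞) be measurable and integrable with respect to both P and Q. Then |CVaR_α(g; P) − CVaR_α(g; Q)| ≤ (1/α)·sup_{θ ∈ ℝ} | E_P[(g − θ)_+] − E_Q[(g − θ)_+] |. -/

import Mathlib

open MeasureTheory Real Set

lemma cvar_aux_bounds {Z : Type*} [MeasurableSpace Z] (P : Measure Z) [IsProbabilityMeasure P]
    (g : Z → ℝ) (h0 : ∀ z, 0 ≤ g z) (hg : Integrable g P) (θ : ℝ) :
    max (-θ) 0 ≤ ∫ z, max (g z - θ) 0 ∂P ∧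
      ∫ z, max (g z - θ) 0 ∂P ≤ max (-θ) 0 + ∫ z, g z ∂P := by
  have hi : Integrable (fun z => max (g z - θ) 0) P :=
    (hg.sub (integrable_const θ)).pos_part
  constructor
  · have h := integral_mono (μ := P) (integrable_const (max (-θ) 0)) hi
      (fun z => max_le_max (by linarith [h0 z]) le_rfl)
    simpa using h
  · have h := integral_mono (μ := P) hi ((integrable_const (max (-θ) 0)).add hg)
      (fun z => by
        have := h0 z
        have h1 := le_max_left (-θ) 0
        have h2 := le_max_right (-θ) 0
        exact max_le (by simp only [Pi.add_apply]; linarith)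
          (by simp only [Pi.add_apply]; linarith))
    rw [integral_add' (integrable_const _) hg] at h
    simpa using h

lemma cvar_aux_inf (α : ℝ) (hα : α ∈ Set.Ioo (0 : ℝ) 1) (F G : ℝ → ℝ) (S : ℝ)
    (hF : ∀ θ, max (-θ) 0 ≤ F θ) (hS : ∀ θ, |F θ - G θ| ≤ S) :
    (⨅ θ : ℝ, θ + (1 / α) * F θ) - (⨅ θ : ℝ, θ + (1 / α) * G θ) ≤ (1 / α) * S := by
  have ha : 1 ≤ 1 / α := by
    rw [le_div_iff₀ hα.1]; linarith [hα.2]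
  have hb : BddBelow (Set.range fun θ : ℝ => θ + (1 / α) * F θ) := by
    refine ⟨0, ?_⟩
    rintro _ ⟨θ, rfl⟩
    have h1 := (le_max_left (-θ) 0).trans (hF θ)
    have h2 := (le_max_right (-θ) 0).trans (hF θ)
    show 0 ≤ θ + (1 / α) * F θ
    nlinarith
  rw [sub_le_comm]
  refine le_ciInf fun θ => ?_
  have h1 := ciInf_le hb θ
  have h2 := mul_le_mul_of_nonneg_left ((le_abs_self _).trans (hS θ)) (by linarith : 0 ≤ 1 / α)
  linarith

/-- **Reduction of CVaR deviations to an empirical-process supremum.**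
For `α ∈ (0,1)`, probability measures `P, Q` on `Z`, and a nonnegative measurable
function `g` integrable for both,
`|CVaR_α(g;P) - CVaR_α(g;Q)| ≤ (1/α) sup_θ |E_P[(g-θ)₊] - E_Q[(g-θ)₊]|`. -/
theorem cvar_deviation_le_sup_empirical_process
    {Z : Type*} [MeasurableSpace Z]
    (P Q : Measure Z) [IsProbabilityMeasure P] [IsProbabilityMeasure Q]
    (α : ℝ) (hα : α ∈ Set.Ioo (0 : ℝ) 1)
    (g : Z → ℝ) (hgmeas : Measurable g) (hgnonneg : ∀ z, 0 ≤ g z)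
    (hgP : Integrable g P) (hgQ : Integrable g Q) :
    |(⨅ θ : ℝ, θ + (1 / α) * ∫ z, max (g z - θ) 0 ∂P)
      - (⨅ θ : ℝ, θ + (1 / α) * ∫ z, max (g z - θ) 0 ∂Q)|
      ≤ (1 / α) * ⨆ θ : ℝ, |(∫ z, max (g z - θ) 0 ∂P) - ∫ z, max (g z - θ) 0 ∂Q| := by
  have hP := cvar_aux_bounds P g hgnonneg hgP
  have hQ := cvar_aux_bounds Q g hgnonneg hgQ
  have hb : BddAbove (Set.range fun θ : ℝ =>
      |(∫ z, max (g z - θ) 0 ∂P) - ∫ z, max (g z - θ) 0 ∂Q|) := by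
    refine ⟨(∫ z, g z ∂P) + ∫ z, g z ∂Q, ?_⟩
    rintro _ ⟨θ, rfl⟩
    have h1 : 0 ≤ ∫ z, g z ∂P := integral_nonneg hgnonneg
    have h2 : 0 ≤ ∫ z, g z ∂Q := integral_nonneg hgnonneg
    have h3 := hP θ
    have h4 := hQ θ
    exact abs_le.2 ⟨by linarith [h3.1, h4.2], by linarith [h3.2, h4.1]⟩
  have hS := fun θ => le_ciSup hb θ
  rw [abs_le']
  refine ⟨cvar_aux_inf α hα _ _ _ (fun θ => (hP θ).1) hS, ?_⟩
  rw [neg_sub]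
  exact cvar_aux_inf α hα _ _ _ (fun θ => (hQ θ).1) (fun θ => by rw [abs_sub_comm]; exact hS θ)
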